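/- arXiv:1907.10690 — 4 statements merged into one kernel-verified Lean document; each statement's English description precedes it below -/
import Mathlib

section
/- In the standing setup (a quasi-cyclic DG-Lie algebra of degree n ≤ 2 with a splitting L = H ⊕ d(K) ⊕ K such that H^i = 0 for i < 0, H^0 is closed under the bracket, H^i and K^i are H^0-submodules for all i, and H ⊥ K), for every p ≥ 2, every g ∈ H^0 and all homogeneous ξ₂,…,ξ_{p+1} ∈ H one has ι_p(g, ξ₂,…,ξ_p) = 0 and {g, ξ₂,…,ξ_{p+1}}_{p+1} = 0, where ι_p and {⋯}_{p+1} are the homotopy-transfer Taylor coefficients and transferred brackets. -/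
/-!
Core definitions: differential graded Lie algebras (DGLAs) over a field `K`,
their cohomology, morphisms, quasi-isomorphisms, zigzags and formality.

A ℤ-graded vector space is encoded as a module `carrier` together with an internal
direct sum decomposition `grading : ℤ → Submodule K carrier`.
-/

/-- A differential graded Lie algebra over `K`.  The differential `d` has degree `+1`,
the bracket `br` is graded skew-symmetric, satisfies the graded Jacobi identity and
`d` is a graded derivation with respect to it. -/
structure DGLA (K : Type) [Field K] : Type 1 where
  carrier : Type
  [acg : AddCommGroup carrier]
  [mod : Module K carrier]
  grading : ℤ → Submodule K carrier
  internal : DirectSum.IsInternal grading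
  d : carrier → carrier
  d_lin : IsLinearMap K d
  d_mem : ∀ i : ℤ, ∀ x ∈ grading i, d x ∈ grading (i + 1)
  d_sq : ∀ x, d (d x) = 0
  br : carrier → carrier → carrier
  br_lin₁ : ∀ y, IsLinearMap K fun x => br x y
  br_lin₂ : ∀ x, IsLinearMap K (br x)
  br_mem : ∀ i j : ℤ, ∀ x ∈ grading i, ∀ y ∈ grading j, br x y ∈ grading (i + j)
  skew : ∀ i j : ℤ, ∀ x ∈ grading i, ∀ y ∈ grading j,
      br x y = -((-1 : K) ^ (i * j) • br y x)
  jacobi : ∀ i j : ℤ, ∀ x ∈ grading i, ∀ y ∈ grading j, ∀ z : carrier,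
      br x (br y z) = br (br x y) z + (-1 : K) ^ (i * j) • br y (br x z)
  leibniz : ∀ i : ℤ, ∀ x ∈ grading i, ∀ y : carrier,
      d (br x y) = br (d x) y + (-1 : K) ^ i • br x (d y)

attribute [instance] DGLA.acg DGLA.mod

variable {K : Type} [Field K]

/-- The differential bundled as a linear map. -/
def DGLA.dHom (A : DGLA K) : A.carrier →ₗ[K] A.carrier := IsLinearMap.mk' A.d A.d_lin

/-- Degree `i` cocycles. -/
def DGLA.cocycles (A : DGLA K) (i : ℤ) : Submodule K A.carrier :=
  A.grading i ⊓ LinearMap.ker A.dHom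

/-- Degree `i` coboundaries. -/
def DGLA.coboundaries (A : DGLA K) (i : ℤ) : Submodule K A.carrier :=
  A.grading i ⊓ LinearMap.range A.dHom

/-- Degree `i` cohomology `H^i(L)` as a quotient vector space. -/
abbrev DGLA.cohomology (A : DGLA K) (i : ℤ) :=
  A.cocycles i ⧸ ((A.coboundaries i).comap (A.cocycles i).subtype)

/-- A morphism of DGLAs. -/
structure DGLAHom (A B : DGLA K) where
  toFun : A.carrier → B.carrier
  lin : IsLinearMap K toFun
  map_grading : ∀ i : ℤ, ∀ x ∈ A.grading i, toFun x ∈ B.grading i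
  map_d : ∀ x, toFun (A.d x) = B.d (toFun x)
  map_br : ∀ x y, toFun (A.br x y) = B.br (toFun x) (toFun y)

/-- `f` is a quasi-isomorphism: it induces bijections on cohomology in every degree. -/
def DGLAHom.IsQuasiIso {A B : DGLA K} (f : DGLAHom A B) : Prop :=
  ∀ i : ℤ,
    (∀ x ∈ A.cocycles i, f.toFun x ∈ B.coboundaries i → x ∈ A.coboundaries i) ∧
    (∀ y ∈ B.cocycles i, ∃ x ∈ A.cocycles i, f.toFun x - y ∈ B.coboundaries i)

/-- There exists a quasi-isomorphism `A → B`. -/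
def QIso (A B : DGLA K) : Prop := ∃ f : DGLAHom A B, f.IsQuasiIso

/-- Two DGLAs are connected by a zigzag of quasi-isomorphisms. -/
inductive ZigzagQIso : DGLA K → DGLA K → Prop
  | of {A B : DGLA K} : QIso A B → ZigzagQIso A B
  | refl (A : DGLA K) : ZigzagQIso A A
  | symm {A B : DGLA K} : ZigzagQIso A B → ZigzagQIso B A
  | trans {A B C : DGLA K} : ZigzagQIso A B → ZigzagQIso B C → ZigzagQIso A C

/-- A DGLA is formal if it is connected by a zigzag of quasi-isomorphisms to a DGLA
with zero differential.  (This is equivalent to being connected by a zigzag of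
quasi-isomorphisms to its cohomology `H^*(L)` endowed with the zero differential and
the induced bracket: any zero-differential DGLA quasi-isomorphic to `L` is isomorphic,
as a graded Lie algebra, to `H^*(L)` with the induced bracket.) -/
def DGLA.IsFormal (A : DGLA K) : Prop :=
  ∃ M : DGLA K, (∀ x, M.d x = 0) ∧ ZigzagQIso A M

/-- A quasi-cyclic DGLA of degree `n`: a DGLA with finite dimensional cohomology
equipped with a graded symmetric bilinear form of degree `-n`, compatible with `d`
and cyclic with respect to the bracket, whose induced pairing on cohomology is
non-degenerate. -/
structure QCyclicDGLA (K : Type) [Field K] (n : ℤ) extends DGLA K where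
  form : carrier → carrier → K
  form_lin₁ : ∀ y, IsLinearMap K fun x => form x y
  form_lin₂ : ∀ x, IsLinearMap K (form x)
  findim : ∀ i : ℤ, FiniteDimensional K (toDGLA.cohomology i)
  form_degree : ∀ i j : ℤ, i + j ≠ n → ∀ x ∈ grading i, ∀ y ∈ grading j, form x y = 0
  form_symm : ∀ i j : ℤ, ∀ x ∈ grading i, ∀ y ∈ grading j,
      form x y = (-1 : K) ^ (i * j) * form y x
  form_d : ∀ i : ℤ, ∀ x ∈ grading i, ∀ y,
      form (d x) y = (-1 : K) ^ (i + 1) * form x (d y)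
  form_cyclic : ∀ x y z, form (br x y) z = form x (br y z)
  nondeg : ∀ i : ℤ, ∀ x ∈ toDGLA.cocycles i,
      (∀ y ∈ toDGLA.cocycles (n - i), form x y = 0) → x ∈ toDGLA.coboundaries i

/-- A splitting `L = H ⊕ d(K) ⊕ K` of the complex `(L, d)` into graded subspaces:
`d` vanishes on `H`, is injective on `K = Kc`, and in every degree `i` one has the
internal direct sum `L^i = H^i ⊕ d(K^{i-1}) ⊕ K^i`. -/
structure GradedSplitting (A : DGLA K) where
  H : ℤ → Submodule K A.carrier
  Kc : ℤ → Submodule K A.carrier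
  H_le : ∀ i, H i ≤ A.grading i
  Kc_le : ∀ i, Kc i ≤ A.grading i
  d_H : ∀ i, ∀ x ∈ H i, A.d x = 0
  d_Kc_inj : ∀ i, ∀ x ∈ Kc i, A.d x = 0 → x = 0
  decomp : ∀ i, H i ⊔ ((Kc (i - 1)).map A.dHom ⊔ Kc i) = A.grading i
  disj₁ : ∀ i, Disjoint (H i) ((Kc (i - 1)).map A.dHom ⊔ Kc i)
  disj₂ : ∀ i, Disjoint ((Kc (i - 1)).map A.dHom) (Kc i)

/-- The contraction data `(π, h)` determined by a splitting `L = H ⊕ d(K) ⊕ K`: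
`pr` is the projection onto `H`, and `h` the degree `-1` homotopy given by projecting
onto `d(K)`, applying `-d⁻¹` and including `K` into `L`.  The listed identities
determine `pr` and `h` uniquely. -/
structure ContractionData (A : DGLA K) (S : GradedSplitting A) where
  pr : A.carrier → A.carrier
  h : A.carrier → A.carrier
  pr_lin : IsLinearMap K pr
  h_lin : IsLinearMap K h
  pr_H : ∀ i : ℤ, ∀ x ∈ S.H i, pr x = x
  pr_dK : ∀ i : ℤ, ∀ x ∈ S.Kc i, pr (A.d x) = 0
  pr_K : ∀ i : ℤ, ∀ x ∈ S.Kc i, pr x = 0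
  h_H : ∀ i : ℤ, ∀ x ∈ S.H i, h x = 0
  h_dK : ∀ i : ℤ, ∀ x ∈ S.Kc i, h (A.d x) = -x
  h_K : ∀ i : ℤ, ∀ x ∈ S.Kc i, h x = 0
/-!  Homotopy transfer: Koszul signs, shuffles, and the recursively defined
Taylor coefficients `ι_p` and transferred brackets `{⋯}_p`. -/

/-- `(-1)^m` in `K` for an integer `m`. -/
def negOnePowK (K : Type) [Field K] (m : ℤ) : K := (-1 : K) ^ m.natAbs

/-- The antisymmetric Koszul sign `χ(σ)` of a permutation `σ` acting on homogeneous
elements of degrees `dg 0, …, dg (P-1)`: a product over the inversions of `σ` of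
`-(-1)^{|ξ_a||ξ_b|}`. -/
def koszulSign (K : Type) [Field K] {P : ℕ} (dg : Fin P → ℤ) (σ : Equiv.Perm (Fin P)) : K :=
  ∏ q ∈ Finset.univ.filter
      (fun q : Fin P × Fin P => q.1 < q.2 ∧ σ q.2 < σ q.1),
    -negOnePowK K (dg (σ q.1) * dg (σ q.2))

/-- The sign `(-1)^{α(σ)}` with `α(σ) = (1-P+k)(k + Σ_{i<k} |ξ_{σ(i)}|)`. -/
def alphaSign (K : Type) [Field K] {P : ℕ} (k : ℕ) (dg : Fin P → ℤ) (σ : Equiv.Perm (Fin P)) : K :=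
  negOnePowK K ((1 - (P : ℤ) + (k : ℤ)) *
    ((k : ℤ) + ∑ i ∈ Finset.univ.filter (fun i : Fin P => (i : ℕ) < k), dg (σ i)))

/-- The set of `(k, P-k)`-shuffles in the symmetric group of `Fin P`. -/
def shuffles (P k : ℕ) : Finset (Equiv.Perm (Fin P)) :=
  Finset.univ.filter fun σ =>
    ∀ i j : Fin P, i < j → ((j : ℕ) < k ∨ k ≤ (i : ℕ)) → σ i < σ j

/-- Auxiliary total indexing function `ℕ → Fin (p+2)` (reduction mod `p+2`);
on the ranges actually used in the transfer formulas it is the obvious inclusion. -/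
def finIdx (p : ℕ) (m : ℕ) : Fin (p + 2) := ⟨m % (p + 2), Nat.mod_lt m (by omega)⟩

/-- The first `j` entries of a `p`-tuple. -/
def tupleTake {M : Type} (p j : ℕ) (h : j ≤ p) (v : Fin p → M) : Fin j → M :=
  fun i => v (Fin.castLE h i)

/-- The last `p - j` entries of a `p`-tuple. -/
def tupleDrop {M : Type} (p j : ℕ) (h : j ≤ p) (v : Fin p → M) : Fin (p - j) → M :=
  fun i => v ⟨j + (i : ℕ), by have := i.isLt; omega⟩

variable {K : Type} [Field K]

/-- The homotopy transfer family associated to a splitting with contraction data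
`(pr, h)`: `ι p` are the Taylor coefficients of the induced `L∞` quasi-isomorphism
`H → L` and `bh p` the transferred higher brackets on `H ≅ H^*(L)`, characterized
(on tuples of homogeneous elements of `H`) by `ι 1 = inclusion` together with the
standard recursive shuffle formulas. -/
structure IsTransfer (A : DGLA K) (S : GradedSplitting A) (C : ContractionData A S)
    (ι : (p : ℕ) → (Fin p → A.carrier) → A.carrier)
    (bh : (p : ℕ) → (Fin p → A.carrier) → A.carrier) : Prop where
  iota_one : ∀ v : Fin 1 → A.carrier, ι 1 v = v 0
  iota_rec : ∀ (p : ℕ) (dg : Fin (p + 2) → ℤ) (v : Fin (p + 2) → A.carrier),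
      (∀ i, v i ∈ S.H (dg i)) →
      ι (p + 2) v = (2 : K)⁻¹ •
        ∑ k ∈ Finset.Ioo 0 (p + 2), ∑ σ ∈ shuffles (p + 2) k,
          (koszulSign K dg σ * alphaSign K k dg σ) •
            C.h (A.br (ι k fun i => v (σ (finIdx p (i : ℕ))))
                 (ι (p + 2 - k) fun i => v (σ (finIdx p (k + (i : ℕ))))))
  bracket_rec : ∀ (p : ℕ) (dg : Fin (p + 2) → ℤ) (v : Fin (p + 2) → A.carrier),
      (∀ i, v i ∈ S.H (dg i)) →
      bh (p + 2) v = (2 : K)⁻¹ •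
        ∑ k ∈ Finset.Ioo 0 (p + 2), ∑ σ ∈ shuffles (p + 2) k,
          (koszulSign K dg σ * alphaSign K k dg σ) •
            C.pr (A.br (ι k fun i => v (σ (finIdx p (i : ℕ))))
                  (ι (p + 2 - k) fun i => v (σ (finIdx p (k + (i : ℕ))))))

/-- The homotopy takes values in the complement `Kc`. -/
theorem ContractionData.h_mem_iSup_Kc {A : DGLA K} {S : GradedSplitting A}
    (C : ContractionData A S) (x : A.carrier) : C.h x ∈ ⨆ i, S.Kc i := by
  have hx : x ∈ ⨆ i, A.grading i := by
    rw [A.internal.submodule_iSup_eq_top]; trivial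
  suffices (⨆ i, A.grading i) ≤ (⨆ i, S.Kc i).comap (C.h_lin.mk' C.h) from this hx
  refine iSup_le fun i => ?_
  rw [← S.decomp i]
  refine sup_le (fun y hy => ?_) (sup_le ?_ fun y hy => ?_)
  · simp [C.h_H i y hy]
  · rintro _ ⟨y, hy, rfl⟩
    have : C.h (A.d y) ∈ ⨆ i, S.Kc i := by
      rw [C.h_dK _ y hy]
      exact neg_mem (Submodule.mem_iSup_of_mem _ hy)
    exact this
  · simp [C.h_K i y hy]

theorem ContractionData.h_eq_zero_of_mem_iSup_H {A : DGLA K} {S : GradedSplitting A}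
    (C : ContractionData A S) {x : A.carrier} (hx : x ∈ ⨆ i, S.H i) : C.h x = 0 :=
  (iSup_le fun i y hy => C.h_H i y hy : (⨆ i, S.H i) ≤ LinearMap.ker (C.h_lin.mk' C.h)) hx

theorem ContractionData.h_eq_zero_of_mem_iSup_Kc {A : DGLA K} {S : GradedSplitting A}
    (C : ContractionData A S) {x : A.carrier} (hx : x ∈ ⨆ i, S.Kc i) : C.h x = 0 :=
  (iSup_le fun i y hy => C.h_K i y hy : (⨆ i, S.Kc i) ≤ LinearMap.ker (C.h_lin.mk' C.h)) hx

theorem ContractionData.pr_eq_zero_of_mem_iSup_Kc {A : DGLA K} {S : GradedSplitting A}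
    (C : ContractionData A S) {x : A.carrier} (hx : x ∈ ⨆ i, S.Kc i) : C.pr x = 0 :=
  (iSup_le fun i y hy => C.pr_K i y hy :
    (⨆ i, S.Kc i) ≤ LinearMap.ker (C.pr_lin.mk' C.pr)) hx

theorem DGLA.br_mem_iSup {A : DGLA K} {W : ℤ → Submodule K A.carrier} {g : A.carrier}
    (hW : ∀ i, ∀ x ∈ W i, A.br g x ∈ W i) {x : A.carrier} (hx : x ∈ ⨆ i, W i) :
    A.br g x ∈ ⨆ i, W i :=
  (iSup_le fun i y hy => Submodule.mem_iSup_of_mem i (hW i y hy) :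
    (⨆ i, W i) ≤ (⨆ i, W i).comap ((A.br_lin₂ g).mk' (A.br g))) hx

theorem DGLA.br_mem_iSup_right {A : DGLA K} {W : ℤ → Submodule K A.carrier} {g : A.carrier}
    (hle : ∀ i, W i ≤ A.grading i) (hg : g ∈ A.grading 0)
    (hW : ∀ i, ∀ x ∈ W i, A.br g x ∈ W i) {x : A.carrier} (hx : x ∈ ⨆ i, W i) :
    A.br x g ∈ ⨆ i, W i := by
  suffices (⨆ i, W i) ≤ (⨆ i, W i).comap ((A.br_lin₁ g).mk' fun x => A.br x g) from this hx
  refine iSup_le fun i y hy => ?_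
  have : A.br y g ∈ ⨆ i, W i := by
    rw [A.skew i 0 y (hle i hy) g hg]
    exact neg_mem (Submodule.smul_mem _ _ (Submodule.mem_iSup_of_mem i (hW i y hy)))
  exact this

/-- A subspace of `L` containing the values of `ι_m`: `H` for `m = 1`, `Kc` otherwise. -/
def GradedSplitting.iotaTarget {A : DGLA K} (S : GradedSplitting A) (m : ℕ) (i : ℤ) :
    Submodule K A.carrier :=
  if m = 1 then S.H i else S.Kc i

theorem GradedSplitting.iotaTarget_le {A : DGLA K} (S : GradedSplitting A) (m : ℕ) (i : ℤ) :
    S.iotaTarget m i ≤ A.grading i := by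
  unfold iotaTarget
  split_ifs
  exacts [S.H_le i, S.Kc_le i]

theorem ContractionData.h_eq_zero_of_mem_iotaTarget {A : DGLA K} {S : GradedSplitting A}
    (C : ContractionData A S) {m : ℕ} {x : A.carrier} (hx : x ∈ ⨆ i, S.iotaTarget m i) :
    C.h x = 0 := by
  unfold GradedSplitting.iotaTarget at hx
  split_ifs at hx
  exacts [C.h_eq_zero_of_mem_iSup_H hx, C.h_eq_zero_of_mem_iSup_Kc hx]

theorem IsTransfer.iota_mem {A : DGLA K} {S : GradedSplitting A} {C : ContractionData A S}
    {ι bh : (p : ℕ) → (Fin p → A.carrier) → A.carrier} (hT : IsTransfer A S C ι bh)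
    {m : ℕ} (hm : 0 < m) (dg : Fin m → ℤ) (v : Fin m → A.carrier)
    (hv : ∀ i, v i ∈ S.H (dg i)) : ι m v ∈ ⨆ i, S.iotaTarget m i := by
  match m, hm with
  | 1, _ =>
    rw [hT.iota_one]
    exact Submodule.mem_iSup_of_mem (dg 0) (by simpa [GradedSplitting.iotaTarget] using hv 0)
  | p + 2, _ =>
    rw [hT.iota_rec p dg v hv]
    simp only [GradedSplitting.iotaTarget, show p + 2 ≠ 1 by omega, if_false]
    exact Submodule.smul_mem _ _ <| Submodule.sum_mem _ fun k _ => Submodule.sum_mem _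
      fun σ _ => Submodule.smul_mem _ _ (C.h_mem_iSup_Kc _)

/-- In a shuffle the smallest index occupies the first place of one of the two blocks. -/
theorem shuffles_zero_position {p k : ℕ} {σ : Equiv.Perm (Fin (p + 2))}
    (hσ : σ ∈ shuffles (p + 2) k) : σ (finIdx p 0) = 0 ∨ σ (finIdx p k) = 0 := by
  simp only [shuffles, Finset.mem_filter, Finset.mem_univ, true_and] at hσ
  have hs : σ (σ.symm 0) = 0 := σ.apply_symm_apply 0
  generalize σ.symm 0 = j at hs
  have key : ∀ i : Fin (p + 2), i < j → ¬((j : ℕ) < k ∨ k ≤ (i : ℕ)) := fun i hij hi => by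
    have := hσ i j hij hi
    rw [hs] at this
    exact absurd this (Fin.not_lt_zero _)
  by_cases hjk : (j : ℕ) < k
  · left
    have : finIdx p 0 = j := by
      by_contra hne
      refine key (finIdx p 0) (Fin.lt_def.2 ?_) (Or.inl hjk)
      have := Fin.val_ne_iff.2 hne
      simp only [finIdx, Nat.zero_mod] at this ⊢
      omega
    rw [this, hs]
  · right
    have hk : k % (p + 2) = k := Nat.mod_eq_of_lt (by omega)
    have : finIdx p k = j := by
      by_contra hne
      have hne := Fin.val_ne_iff.2 hne
      simp only [finIdx, hk] at hne
      refine key (finIdx p k) (Fin.lt_def.2 ?_) (Or.inr ?_) <;> simp only [finIdx, hk] <;> omega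
    rw [this, hs]

/-- If the `ι_m` with `2 ≤ m ≤ p + 1` vanish when the first argument lies in `H^0`, then
every bracket in the transfer recursion of arity `p + 2` lies in the subspace containing the
values of `ι_{p+1}`. -/
theorem IsTransfer.br_iota_mem {A : DGLA K} {S : GradedSplitting A} {C : ContractionData A S}
    {ι bh : (p : ℕ) → (Fin p → A.carrier) → A.carrier} (hT : IsTransfer A S C ι bh)
    (hH : ∀ i : ℤ, ∀ g ∈ S.H 0, ∀ x ∈ S.H i, A.br g x ∈ S.H i)
    (hK : ∀ i : ℤ, ∀ g ∈ S.H 0, ∀ x ∈ S.Kc i, A.br g x ∈ S.Kc i)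
    {p : ℕ}
    (ih : ∀ m, 2 ≤ m → m < p + 2 → ∀ (h0 : 0 < m) (dg : Fin m → ℤ) (v : Fin m → A.carrier),
      (∀ i, v i ∈ S.H (dg i)) → dg ⟨0, h0⟩ = 0 → ι m v = 0)
    {dg : Fin (p + 2) → ℤ} {v : Fin (p + 2) → A.carrier}
    (hv : ∀ i, v i ∈ S.H (dg i)) (hdg : dg 0 = 0)
    {k m : ℕ} (hk : 0 < k) (hm : 0 < m) (hkm : k + m = p + 2)
    {σ : Equiv.Perm (Fin (p + 2))} (hσ : σ ∈ shuffles (p + 2) k) :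
    A.br (ι k fun i => v (σ (finIdx p (i : ℕ))))
      (ι m fun i => v (σ (finIdx p (k + (i : ℕ))))) ∈ ⨆ i, S.iotaTarget (p + 1) i := by
  have hg : v 0 ∈ S.H 0 := hdg ▸ hv 0
  have hW : ∀ i, ∀ x ∈ S.iotaTarget (p + 1) i, A.br (v 0) x ∈ S.iotaTarget (p + 1) i := by
    intro i
    unfold GradedSplitting.iotaTarget
    split_ifs
    exacts [hH i _ hg, hK i _ hg]
  have hl := hT.iota_mem hk (fun i => dg (σ (finIdx p (i : ℕ))))
    (fun i => v (σ (finIdx p (i : ℕ)))) fun _ => hv _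
  have hr := hT.iota_mem hm (fun i => dg (σ (finIdx p (k + (i : ℕ)))))
    (fun i => v (σ (finIdx p (k + (i : ℕ))))) fun _ => hv _
  rcases shuffles_zero_position hσ with h | h
  · obtain rfl | hk2 : k = 1 ∨ 2 ≤ k := by omega
    · obtain rfl : m = p + 1 := by omega
      rw [hT.iota_one, Fin.val_zero, h]
      exact A.br_mem_iSup hW hr
    · rw [ih k hk2 (by omega) hk (fun i => dg (σ (finIdx p (i : ℕ)))) _ (fun _ => hv _)
        (by simp only [h, hdg]), (A.br_lin₁ _).map_zero]
      exact zero_mem _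
  · obtain rfl | hm2 : m = 1 ∨ 2 ≤ m := by omega
    · obtain rfl : k = p + 1 := by omega
      rw [hT.iota_one fun i => v (σ (finIdx p (p + 1 + (i : ℕ)))), Fin.val_zero, add_zero, h]
      exact A.br_mem_iSup_right (S.iotaTarget_le _) (S.H_le 0 hg) hW hl
    · rw [ih m hm2 (by omega) hm (fun i => dg (σ (finIdx p (k + (i : ℕ))))) _ (fun _ => hv _)
        (by simp only [add_zero, h, hdg]), (A.br_lin₂ _).map_zero]
      exact zero_mem _

/-- The Taylor coefficients `ι_p`, `p ≥ 2`, vanish when the first argument lies in `H^0`. -/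
theorem IsTransfer.iota_eq_zero {A : DGLA K} {S : GradedSplitting A} {C : ContractionData A S}
    {ι bh : (p : ℕ) → (Fin p → A.carrier) → A.carrier} (hT : IsTransfer A S C ι bh)
    (hH : ∀ i : ℤ, ∀ g ∈ S.H 0, ∀ x ∈ S.H i, A.br g x ∈ S.H i)
    (hK : ∀ i : ℤ, ∀ g ∈ S.H 0, ∀ x ∈ S.Kc i, A.br g x ∈ S.Kc i)
    (p : ℕ) (hp : 2 ≤ p) (h0 : 0 < p) (dg : Fin p → ℤ) (v : Fin p → A.carrier)
    (hv : ∀ i, v i ∈ S.H (dg i)) (hdg : dg ⟨0, h0⟩ = 0) : ι p v = 0 := by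
  induction p using Nat.strong_induction_on with
  | _ p ih =>
    obtain ⟨p, rfl⟩ := Nat.exists_eq_add_of_le' hp
    rw [hT.iota_rec p dg v hv]
    refine smul_eq_zero_of_right _ (Finset.sum_eq_zero fun k hk => Finset.sum_eq_zero fun σ hσ => ?_)
    rw [Finset.mem_Ioo] at hk
    rw [C.h_eq_zero_of_mem_iotaTarget (hT.br_iota_mem hH hK
      (fun m hm hmp h0 dg v => ih m hmp hm h0 dg v) hv hdg hk.1 (by omega) (by omega) hσ),
      smul_zero]

/-- **Lemma (vanishing on `H^0`).**  In the standing setup (quasi-cyclic of degree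
`n ≤ 2`, splitting with `H^i = 0` for `i < 0`, `H^0` bracket-closed, `H^i`, `K^i`
being `H^0`-submodules for all `i`, and `H ⊥ K`): for every `p ≥ 2`, every `g ∈ H^0`
and all homogeneous `ξ₂, …, ξ_{p+1} ∈ H` one has `ι_p(g, ξ₂, …, ξ_p) = 0` and
`{g, ξ₂, …, ξ_{p+1}}_{p+1} = 0`. -/
theorem transfer_vanishing_on_H0
    {K : Type} [Field K] [CharZero K] {n : ℤ} (hn : n ≤ 2)
    (A : QCyclicDGLA K n) (S : GradedSplitting A.toDGLA)
    (h1 : ∀ i : ℤ, i < 0 → S.H i = ⊥)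
    (h2 : ∀ x ∈ S.H 0, ∀ y ∈ S.H 0, A.br x y ∈ S.H 0)
    (h3H : ∀ i : ℤ, ∀ g ∈ S.H 0, ∀ x ∈ S.H i, A.br g x ∈ S.H i)
    (h3K : ∀ i : ℤ, ∀ g ∈ S.H 0, ∀ x ∈ S.Kc i, A.br g x ∈ S.Kc i)
    (hperp : ∀ i j : ℤ, ∀ x ∈ S.H i, ∀ y ∈ S.Kc j, A.form x y = 0)
    (C : ContractionData A.toDGLA S)
    (ι bh : (p : ℕ) → (Fin p → A.carrier) → A.carrier)
    (hT : IsTransfer A.toDGLA S C ι bh) :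
    -- `ι_p (g, ξ₂, …, ξ_p) = 0` for `p ≥ 2`
    (∀ (p : ℕ) (hp : 2 ≤ p) (dg : Fin p → ℤ) (v : Fin p → A.carrier),
      (∀ i, v i ∈ S.H (dg i)) → dg ⟨0, by omega⟩ = 0 → ι p v = 0) ∧
    -- `{g, ξ₂, …, ξ_{p+1}}_{p+1} = 0` for `p ≥ 2`
    (∀ (p : ℕ) (hp : 2 ≤ p) (dg : Fin (p + 1) → ℤ) (v : Fin (p + 1) → A.carrier),
      (∀ i, v i ∈ S.H (dg i)) → dg ⟨0, by omega⟩ = 0 → bh (p + 1) v = 0) := by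
  refine ⟨fun p hp dg v hv hdg => hT.iota_eq_zero h3H h3K p hp _ dg v hv hdg,
    fun p hp dg v hv hdg => ?_⟩
  obtain ⟨p, rfl⟩ := Nat.exists_eq_add_of_le' hp
  rw [hT.bracket_rec (p + 1) dg v hv]
  refine smul_eq_zero_of_right _ (Finset.sum_eq_zero fun k hk => Finset.sum_eq_zero fun σ hσ => ?_)
  rw [Finset.mem_Ioo] at hk
  have hmem := hT.br_iota_mem h3H h3K
    (fun m hm _ h0 dg v => hT.iota_eq_zero h3H h3K m hm h0 dg v) hv hdg hk.1
    (show 0 < p + 1 + 2 - k by omega) (by omega) hσ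
  simp only [GradedSplitting.iotaTarget, show p + 1 + 1 ≠ 1 by omega, if_false] at hmem
  rw [C.pr_eq_zero_of_mem_iSup_Kc hmem, smul_zero]
end

section
/- In the standing setup of degree 2 (a quasi-cyclic DG-Lie algebra of degree 2 with a splitting L = H ⊕ d(K) ⊕ K such that H^i = 0 for i < 0, H^0 is closed under the bracket, H^i and K^i are H^0-submodules for all i, and H ⊥ K), for every m ≥ 2 and all ξ₁,…,ξ_{m+1} ∈ H^1 one has π[ι_m(ξ₁,…,ξ_m), ι₁(ξ_{m+1})] = 0. Consequently, for every p ≥ 3 and all ξ₁,…,ξ_p ∈ H^1, {ξ₁,…,ξ_p}_p = (1/2) Σ_{k=2}^{p-2} Σ_{σ∈S(k,p-k)} π[ι_k(ξ_{σ(1)},…,ξ_{σ(k)}), ι_{p-k}(ξ_{σ(k+1)},…,ξ_{σ(p)})], and in particular {ξ₁,ξ₂,ξ₃}₃ = 0 for all ξ₁,ξ₂,ξ₃ ∈ H^1. -/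
variable {K : Type} [Field K]

variable {K : Type} [Field K]

namespace GradedSplitting

variable {A : DGLA K} (S : GradedSplitting A)

theorem exists_decomp {i : ℤ} {x : A.carrier} (hx : x ∈ A.grading i) :
    ∃ a ∈ S.H i, ∃ b ∈ S.Kc (i - 1), ∃ c ∈ S.Kc i, x = a + (A.d b + c) := by
  rw [← S.decomp i] at hx
  obtain ⟨a, ha, y, hy, rfl⟩ := Submodule.mem_sup.mp hx
  obtain ⟨_, ⟨b, hb, rfl⟩, c, hc, rfl⟩ := Submodule.mem_sup.mp hy
  exact ⟨a, ha, b, hb, c, hc, rfl⟩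

end GradedSplitting

namespace ContractionData

variable {A : DGLA K} {S : GradedSplitting A} (C : ContractionData A S)

theorem h_mem {i : ℤ} {x : A.carrier} (hx : x ∈ A.grading i) : C.h x ∈ S.Kc (i - 1) := by
  obtain ⟨a, ha, b, hb, c, hc, rfl⟩ := S.exists_decomp hx
  rw [C.h_lin.map_add, C.h_lin.map_add, C.h_H i a ha, C.h_dK _ b hb, C.h_K i c hc, zero_add,
    add_zero]
  exact neg_mem hb

theorem exists_eq_pr_add {i : ℤ} {x : A.carrier} (hx : x ∈ A.grading i) :
    C.pr x ∈ S.H i ∧ ∃ b ∈ S.Kc (i - 1), ∃ c ∈ S.Kc i, x = C.pr x + (A.d b + c) := by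
  obtain ⟨a, ha, b, hb, c, hc, rfl⟩ := S.exists_decomp hx
  have : C.pr (a + (A.d b + c)) = a := by
    rw [C.pr_lin.map_add, C.pr_lin.map_add, C.pr_H i a ha, C.pr_dK _ b hb, C.pr_K i c hc,
      add_zero, add_zero]
  rw [this]
  exact ⟨ha, b, hb, c, hc, rfl⟩

theorem pr_d (x : A.carrier) : C.pr (A.d x) = 0 := by
  have hx : x ∈ ⨆ i, A.grading i := by
    rw [A.internal.submodule_iSup_eq_top]; trivial
  induction hx using Submodule.iSup_induction' with
  | mem i x hx =>
    obtain ⟨a, ha, b, _, c, hc, rfl⟩ := S.exists_decomp hx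
    rw [A.d_lin.map_add, A.d_lin.map_add, S.d_H i a ha, A.d_sq, zero_add, zero_add,
      C.pr_dK i c hc]
  | zero => rw [A.d_lin.map_zero, C.pr_lin.map_zero]
  | add x y _ _ hx hy => rw [A.d_lin.map_add, C.pr_lin.map_add, hx, hy, add_zero]

end ContractionData

namespace QCyclicDGLA

variable {n : ℤ} (A : QCyclicDGLA K n)

theorem form_d_eq_zero {i : ℤ} {x y : A.carrier} (hx : x ∈ A.grading i) (hy : A.d y = 0) :
    A.form (A.d x) y = 0 := by
  rw [A.form_d i x hx, hy, (A.form_lin₂ x).map_zero, mul_zero]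

theorem form_eq_zero_symm {i j : ℤ} {x y : A.carrier} (hx : x ∈ A.grading i)
    (hy : y ∈ A.grading j) (h : A.form x y = 0) : A.form y x = 0 := by
  rw [A.form_symm j i y hy x hx, h, mul_zero]

variable {A} {S : GradedSplitting A.toDGLA} (C : ContractionData A.toDGLA S)

/-- A homogeneous element orthogonal to `H` of complementary degree has no harmonic part. -/
theorem pr_eq_zero_of_form_eq_zero
    (hperp : ∀ i j : ℤ, ∀ x ∈ S.H i, ∀ y ∈ S.Kc j, A.form x y = 0)
    {i : ℤ} {y : A.carrier} (hy : y ∈ A.grading i)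
    (h : ∀ g ∈ S.H (n - i), A.form y g = 0) : C.pr y = 0 := by
  obtain ⟨hpr, b, hb, c, hc, hyeq⟩ := C.exists_eq_pr_add hy
  have hdpr : A.d (C.pr y) = 0 := S.d_H i _ hpr
  have hcob : C.pr y ∈ A.coboundaries i := by
    refine A.nondeg i _ ⟨S.H_le i hpr, hdpr⟩ fun z hz => ?_
    obtain ⟨a, ha, e, he, f, hf, rfl⟩ := S.exists_decomp hz.1
    have hdz : A.d (a + (A.d e + f)) = 0 := hz.2
    rw [A.d_lin.map_add, A.d_lin.map_add, S.d_H _ a ha, A.d_sq, zero_add, zero_add] at hdz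
    obtain rfl := S.d_Kc_inj _ f hf hdz
    have h₁ : A.form (C.pr y) (A.d e) = 0 :=
      A.form_eq_zero_symm (A.d_mem _ _ (S.Kc_le _ he)) (S.H_le i hpr)
        (A.form_d_eq_zero (S.Kc_le _ he) hdpr)
    have h₂ : A.form (C.pr y) a = 0 := by
      have := h a ha
      rw [hyeq, (A.form_lin₁ a).map_add, (A.form_lin₁ a).map_add,
        A.form_d_eq_zero (S.Kc_le _ hb) (S.d_H _ a ha),
        A.form_eq_zero_symm (S.H_le _ ha) (S.Kc_le _ hc) (hperp _ _ a ha c hc)] at this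
      simpa using this
    rw [(A.form_lin₂ _).map_add, (A.form_lin₂ _).map_add, h₁, h₂, (A.form_lin₂ _).map_zero]
    simp
  obtain ⟨z, hz⟩ := hcob.2
  have hz : A.d z = C.pr y := hz
  rw [← C.pr_H i _ hpr, ← hz, C.pr_d]

end QCyclicDGLA

theorem negOnePowK_even {m : ℤ} (hm : Even m) : negOnePowK K m = 1 :=
  Even.neg_one_pow (Int.natAbs_even.mpr hm)

theorem koszulSign_degree_one {P : ℕ} (σ : Equiv.Perm (Fin P)) :
    koszulSign K (fun _ => 1) σ = 1 :=
  Finset.prod_eq_one fun _ _ => by simp [negOnePowK]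

theorem alphaSign_degree_one {P k : ℕ} (hk : k < P) (σ : Equiv.Perm (Fin P)) :
    alphaSign K k (fun _ => 1) σ = 1 := by
  refine negOnePowK_even (Even.mul_left ?_ _)
  have : (Finset.univ.filter fun i : Fin P => (i : ℕ) < k).card = k := by
    have := Fin.card_filter_val_lt (n := P) (m := k)
    omega
  simp [this]

namespace IsTransfer

variable {A : DGLA K} {S : GradedSplitting A} {C : ContractionData A S}
  {ι bh : (p : ℕ) → (Fin p → A.carrier) → A.carrier}

theorem iota_mem_grading_one (hT : IsTransfer A S C ι bh) {m : ℕ} (hm : 1 ≤ m)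
    {v : Fin m → A.carrier} (hv : ∀ i, v i ∈ S.H 1) :
    ι m v ∈ A.grading 1 ∧ (2 ≤ m → ι m v ∈ S.Kc 1) := by
  induction m using Nat.strong_induction_on with
  | _ m ih =>
    obtain rfl | ⟨p, rfl⟩ : m = 1 ∨ ∃ p, m = p + 2 := by
      rcases hm.eq_or_lt with h | h
      · exact .inl h.symm
      · exact .inr ⟨m - 2, by omega⟩
    · rw [hT.iota_one]
      exact ⟨S.H_le 1 (hv 0), fun h => by omega⟩
    · suffices h : ι (p + 2) v ∈ S.Kc 1 from ⟨S.Kc_le 1 h, fun _ => h⟩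
      rw [hT.iota_rec p (fun _ => 1) v hv]
      refine Submodule.smul_mem _ _ (Submodule.sum_mem _ fun k hk => Submodule.sum_mem _
        fun σ _ => Submodule.smul_mem _ _ ?_)
      have hk := Finset.mem_Ioo.mp hk
      exact C.h_mem (i := 2) (A.br_mem 1 1 _ (ih k hk.2 hk.1 fun _ => hv _).1 _
        (ih (p + 2 - k) (by omega) (by omega) fun _ => hv _).1)

theorem bracket_degree_one (hT : IsTransfer A S C ι bh) {p : ℕ}
    {v : Fin (p + 2) → A.carrier} (hv : ∀ i, v i ∈ S.H 1) :
    bh (p + 2) v = (2 : K)⁻¹ •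
      ∑ k ∈ Finset.Ioo 0 (p + 2), ∑ σ ∈ shuffles (p + 2) k,
        C.pr (A.br (ι k fun i => v (σ (finIdx p (i : ℕ))))
          (ι (p + 2 - k) fun i => v (σ (finIdx p (k + (i : ℕ)))))) := by
  rw [hT.bracket_rec p (fun _ => 1) v hv]
  congr 1
  refine Finset.sum_congr rfl fun k hk => Finset.sum_congr rfl fun σ _ => ?_
  rw [koszulSign_degree_one, alphaSign_degree_one (Finset.mem_Ioo.mp hk).2, one_mul, one_smul]

end IsTransfer

/-- **Lemma.**  In the standing setup of degree `2`: for every `m ≥ 2` and all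
`ξ₁, …, ξ_{m+1} ∈ H^1` one has `π [ι_m(ξ₁, …, ξ_m), ι₁(ξ_{m+1})] = 0`.  Consequently
for `p ≥ 3` and `ξ₁, …, ξ_p ∈ H^1` the shuffle sum computing `{ξ₁, …, ξ_p}_p` only
involves the terms with `2 ≤ k ≤ p - 2` (all Koszul signs being `+1` on `H^1`), and
in particular `{ξ₁, ξ₂, ξ₃}₃ = 0` on `H^1`. -/
theorem transfer_triple_vanishing_degree_one
    {K : Type} [Field K] [CharZero K]
    (A : QCyclicDGLA K 2) (S : GradedSplitting A.toDGLA)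
    (h1 : ∀ i : ℤ, i < 0 → S.H i = ⊥)
    (h2 : ∀ x ∈ S.H 0, ∀ y ∈ S.H 0, A.br x y ∈ S.H 0)
    (h3H : ∀ i : ℤ, ∀ g ∈ S.H 0, ∀ x ∈ S.H i, A.br g x ∈ S.H i)
    (h3K : ∀ i : ℤ, ∀ g ∈ S.H 0, ∀ x ∈ S.Kc i, A.br g x ∈ S.Kc i)
    (hperp : ∀ i j : ℤ, ∀ x ∈ S.H i, ∀ y ∈ S.Kc j, A.form x y = 0)
    (C : ContractionData A.toDGLA S)
    (ι bh : (p : ℕ) → (Fin p → A.carrier) → A.carrier)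
    (hT : IsTransfer A.toDGLA S C ι bh) :
    -- `π [ι_m (ξ₁, …, ξ_m), ι₁ ξ_{m+1}] = 0`
    (∀ (m : ℕ), 2 ≤ m → ∀ v : Fin m → A.carrier, (∀ i, v i ∈ S.H 1) →
      ∀ ξ ∈ S.H 1, C.pr (A.br (ι m v) ξ) = 0) ∧
    -- `{ξ₁,…,ξ_p}_p = (1/2) Σ_{k=2}^{p-2} Σ_{σ ∈ S(k,p-k)} π[ι_k(…), ι_{p-k}(…)]`
    (∀ (p : ℕ), 3 ≤ p → ∀ v : Fin p → A.carrier, (∀ i, v i ∈ S.H 1) →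
      bh p v = (2 : K)⁻¹ •
        ∑ k ∈ (Finset.Icc 2 (p - 2)).attach, ∑ σ ∈ shuffles p k.1,
          C.pr (A.br
            (ι k.1 (tupleTake p k.1
              (by have := (Finset.mem_Icc.mp k.2).2; omega) (fun i => v (σ i))))
            (ι (p - k.1) (tupleDrop p k.1
              (by have := (Finset.mem_Icc.mp k.2).2; omega) (fun i => v (σ i)))))) ∧
    -- `{ξ₁, ξ₂, ξ₃}₃ = 0`
    (∀ v : Fin 3 → A.carrier, (∀ i, v i ∈ S.H 1) → bh 3 v = 0) := by
  have hvan : ∀ (m : ℕ), 2 ≤ m → ∀ v : Fin m → A.carrier, (∀ i, v i ∈ S.H 1) →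
      ∀ ξ ∈ S.H 1, C.pr (A.br (ι m v) ξ) = 0 := by
    intro m hm v hv ξ hξ
    obtain ⟨hdeg, hK⟩ := hT.iota_mem_grading_one (by omega) hv
    refine A.pr_eq_zero_of_form_eq_zero C hperp (i := 2)
      (A.br_mem 1 1 _ hdeg _ (S.H_le 1 hξ)) fun g hg => ?_
    have hg : g ∈ S.H 0 := hg
    have hmem : A.br ξ g ∈ S.H 1 := by
      rw [A.skew 1 0 ξ (S.H_le 1 hξ) g (S.H_le 0 hg)]
      exact neg_mem (Submodule.smul_mem _ _ (h3H 1 g hg ξ hξ))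
    rw [A.form_cyclic]
    exact A.form_eq_zero_symm (S.H_le 1 hmem) hdeg (hperp 1 1 _ hmem _ (hK hm))
  have hbr : ∀ (p : ℕ), 3 ≤ p → ∀ v : Fin p → A.carrier, (∀ i, v i ∈ S.H 1) →
      bh p v = (2 : K)⁻¹ •
        ∑ k ∈ (Finset.Icc 2 (p - 2)).attach, ∑ σ ∈ shuffles p k.1,
          C.pr (A.br
            (ι k.1 (tupleTake p k.1
              (by have := (Finset.mem_Icc.mp k.2).2; omega) (fun i => v (σ i))))
            (ι (p - k.1) (tupleDrop p k.1
              (by have := (Finset.mem_Icc.mp k.2).2; omega) (fun i => v (σ i))))) := by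
    intro p hp v hv
    obtain ⟨p, rfl⟩ : ∃ q, p = q + 2 := ⟨p - 2, by omega⟩
    rw [hT.bracket_degree_one hv]
    congr 1
    have hsub : Finset.Icc 2 (p + 2 - 2) ⊆ Finset.Ioo 0 (p + 2) := fun k hk => by
      simp only [Finset.mem_Icc, Finset.mem_Ioo] at hk ⊢
      omega
    rw [← Finset.sum_subset hsub, ← Finset.sum_attach]
    · refine Finset.sum_congr rfl fun k _ => Finset.sum_congr rfl fun σ _ => ?_
      have hk := Finset.mem_Icc.mp k.2
      congr 3
      · funext i
        have : finIdx p i = Fin.castLE (by omega) i :=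
          Fin.ext (Nat.mod_eq_of_lt (by have := i.isLt; omega))
        rw [this, tupleTake]
      · funext i
        have : finIdx p (k.1 + i) = ⟨k.1 + i, by have := i.isLt; omega⟩ :=
          Fin.ext (Nat.mod_eq_of_lt (by have := i.isLt; omega))
        rw [this, tupleDrop]
    · intro k hk hk'
      simp only [Finset.mem_Icc, Finset.mem_Ioo] at hk hk'
      refine Finset.sum_eq_zero fun σ _ => ?_
      obtain rfl | hk1 := eq_or_ne k 1
      · have hι := (hT.iota_mem_grading_one (m := p + 2 - 1) (by omega)
          (v := fun i => v (σ (finIdx p (1 + (i : ℕ))))) fun _ => hv _).1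
        rw [hT.iota_one, A.skew 1 1 _ (S.H_le 1 (hv _)) _ hι]
        simpa using hvan (p + 2 - 1) (by omega) _ (fun _ => hv _) _ (hv _)
      · obtain rfl : k = p + 1 := by omega
        have hlast : ∀ w : Fin (p + 2 - (p + 1)) → A.carrier, (∀ i, w i ∈ S.H 1) →
            ι (p + 2 - (p + 1)) w ∈ S.H 1 := by
          rw [show p + 2 - (p + 1) = 1 by omega]
          intro w hw
          rw [hT.iota_one]
          exact hw 0
        exact hvan (p + 1) (by omega) _ (fun _ => hv _) _ (hlast _ fun _ => hv _)
  refine ⟨hvan, hbr, fun v hv => ?_⟩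
  rw [hbr 3 le_rfl v hv]
  rw [Finset.sum_eq_zero, smul_zero]
  intro k _
  have := Finset.mem_Icc.mp k.2
  omega
end

section
/- In the standing setup of degree 2 (a quasi-cyclic DG-Lie algebra of degree 2 with a splitting L = H ⊕ d(K) ⊕ K such that H^i = 0 for i < 0, H^0 is closed under the bracket, H^i and K^i are H^0-submodules for all i, and H ⊥ K), for every p ≥ 1, all ξ₁,…,ξ_p ∈ H^1 and every g ∈ H^0 one has the equivariance identity [ι_p(ξ₁,…,ξ_p), ι₁(g)] = Σ_{i=1}^p ι_p(ξ₁,…,{ξ_i,g}₂,…,ξ_p), where {ξ,g}₂ = π[ι₁(ξ), ι₁(g)] is the transferred binary bracket. -/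
variable {K : Type} [Field K]

variable {K : Type} [Field K]

/-- An additive property of vectors that holds on all homogeneous elements holds everywhere. -/
theorem DGLA.induction_homogeneous {K : Type} [Field K] (A : DGLA K) {P : A.carrier → Prop}
    (hom : ∀ i : ℤ, ∀ x ∈ A.grading i, P x) (zero : P 0)
    (add : ∀ x y, P x → P y → P (x + y)) (x : A.carrier) : P x := by
  have hx : x ∈ ⨆ i, A.grading i := by
    rw [A.internal.submodule_iSup_eq_top]
    exact Submodule.mem_top
  exact Submodule.iSup_induction A.grading (motive := P) hx hom zero add

/-- Skew-symmetry against an element of degree `0` carries no sign. -/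
theorem DGLA.br_skew_of_degree_zero {K : Type} [Field K] (A : DGLA K) {g : A.carrier}
    (hg : g ∈ A.grading 0) (x : A.carrier) : A.br x g = -A.br g x := by
  refine A.induction_homogeneous (P := fun x => A.br x g = -A.br g x) ?_ ?_ ?_ x
  · intro i x hx
    simpa using A.skew i 0 x hx g hg
  · rw [(A.br_lin₁ g).map_zero, (A.br_lin₂ g).map_zero, neg_zero]
  · intro x y hx hy
    rw [(A.br_lin₁ g).map_add, (A.br_lin₂ g).map_add, hx, hy, neg_add]

/-- The right bracket with an element of degree `0` is a derivation of the bracket. -/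
theorem DGLA.br_br_of_degree_zero {K : Type} [Field K] (A : DGLA K) {g : A.carrier}
    (hg : g ∈ A.grading 0) (x y : A.carrier) :
    A.br (A.br x y) g = A.br (A.br x g) y + A.br x (A.br y g) := by
  have key : A.br g (A.br x y) = A.br (A.br g x) y + A.br x (A.br g y) := by
    refine A.induction_homogeneous
      (P := fun x => A.br g (A.br x y) = A.br (A.br g x) y + A.br x (A.br g y)) ?_ ?_ ?_ x
    · intro i x hx
      simpa using A.jacobi 0 i g hg x hx y
    · simp only [(A.br_lin₁ _).map_zero, (A.br_lin₂ _).map_zero, add_zero]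
    · intro x z hx hz
      simp only [(A.br_lin₁ _).map_add, (A.br_lin₂ _).map_add, hx, hz]
      abel
  rw [A.br_skew_of_degree_zero hg, key, A.br_skew_of_degree_zero hg x,
    A.br_skew_of_degree_zero hg y, (A.br_lin₁ y).map_neg, (A.br_lin₂ x).map_neg, neg_add]

/-- The homotopy of a contraction commutes with the bracket by `g ∈ H⁰` whenever `H` and `K`
are stable under the adjoint action of `g`. -/
theorem ContractionData.h_br {K : Type} [Field K] {A : DGLA K} {S : GradedSplitting A}
    (C : ContractionData A S) {g : A.carrier} (hg : g ∈ S.H 0)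
    (hH : ∀ i : ℤ, ∀ x ∈ S.H i, A.br g x ∈ S.H i)
    (hK : ∀ i : ℤ, ∀ x ∈ S.Kc i, A.br g x ∈ S.Kc i) (x : A.carrier) :
    C.h (A.br x g) = A.br (C.h x) g := by
  have hg0 := S.H_le 0 hg
  rw [A.br_skew_of_degree_zero hg0, A.br_skew_of_degree_zero hg0, C.h_lin.map_neg]
  congr 1
  refine A.induction_homogeneous (P := fun x => C.h (A.br g x) = A.br g (C.h x)) ?_ ?_ ?_ x
  · intro i x hx
    rw [← S.decomp i] at hx
    obtain ⟨a, ha, _, hb, rfl⟩ := Submodule.mem_sup.1 hx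
    obtain ⟨_, ⟨k, hk, rfl⟩, c, hc, rfl⟩ := Submodule.mem_sup.1 hb
    have hd : A.br g (A.dHom k) = A.d (A.br g k) := by
      have := A.leibniz 0 g hg0 k
      rw [S.d_H 0 g hg, (A.br_lin₁ k).map_zero] at this
      simpa using! this.symm
    have hdk : C.h (A.dHom k) = -k := C.h_dK _ k hk
    simp only [(A.br_lin₂ g).map_add, C.h_lin.map_add]
    rw [C.h_H i a ha, C.h_K i c hc, C.h_H i _ (hH i a ha), C.h_K i _ (hK i c hc), hd,
      C.h_dK _ _ (hK _ k hk), hdk, (A.br_lin₂ g).map_neg, (A.br_lin₂ g).map_zero]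
  · simp only [(A.br_lin₂ g).map_zero, C.h_lin.map_zero]
  · intro x y hx hy
    simp only [(A.br_lin₂ g).map_add, C.h_lin.map_add, hx, hy]

/-- The two blocks `{0, …, k-1}` and `{k, …, p+1}` exhaust `Fin (p + 2)`. -/
theorem finIdx_sum_bijective {p k : ℕ} (hk : k < p + 2) :
    Function.Bijective (Sum.elim (fun i : Fin k => finIdx p (i : ℕ))
      (fun i : Fin (p + 2 - k) => finIdx p (k + (i : ℕ)))) := by
  rw [Fintype.bijective_iff_injective_and_card]
  refine ⟨?_, by simp; omega⟩
  rintro (⟨i, hi⟩ | ⟨i, hi⟩) (⟨j, hj⟩ | ⟨j, hj⟩) h <;>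
    simp only [Sum.elim_inl, Sum.elim_inr, finIdx, Fin.mk.injEq] at h <;>
    rw [Nat.mod_eq_of_lt (by omega), Nat.mod_eq_of_lt (by omega)] at h
  · simp [h]
  · omega
  · omega
  · simp; omega

/-- Leibniz rule for evaluating a biadditive map on two complementary blocks of a tuple, when a
derivation acts on each block through its entries. -/
theorem derivation_blocks {α β γ M : Type} [Fintype α] [Fintype β] [Fintype γ]
    [DecidableEq α] [DecidableEq β] [DecidableEq γ] [AddCommGroup M]
    {e : α → γ} {f : β → γ} (hef : Function.Bijective (Sum.elim e f))
    (B : M →+ M →+ M) (D : M → M) (hD : ∀ x y, D (B x y) = B (D x) y + B x (D y))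
    (F : (α → M) → M) (G : (β → M) → M) (v : γ → M)
    (hF : D (F fun i => v (e i)) = ∑ i, F (Function.update (fun i => v (e i)) i (D (v (e i)))))
    (hG : D (G fun i => v (f i)) = ∑ i, G (Function.update (fun i => v (f i)) i (D (v (f i))))) :
    D (B (F fun i => v (e i)) (G fun i => v (f i))) =
      ∑ j, B (F fun i => Function.update v j (D (v j)) (e i))
        (G fun i => Function.update v j (D (v j)) (f i)) := by
  have he : Function.Injective e := fun a b h => Sum.inl_injective (hef.1 h)
  have hf : Function.Injective f := fun a b h => Sum.inr_injective (hef.1 h)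
  have hne : ∀ a b, e a ≠ f b := fun a b h => Sum.inl_ne_inr (hef.1 h)
  rw [hD, hF, hG, ← hef.sum_comp, Fintype.sum_sum_type, map_sum, map_sum,
    AddMonoidHom.finsetSum_apply]
  congr 1 <;> refine Finset.sum_congr rfl fun i _ => ?_
  · have h₁ : (fun a => Function.update v (e i) (D (v (e i))) (e a)) =
        Function.update (fun a => v (e a)) i (D (v (e i))) :=
      Function.update_comp_eq_of_injective v he i _
    have h₂ : (fun b => Function.update v (e i) (D (v (e i))) (f b)) = fun b => v (f b) :=
      funext fun b => Function.update_of_ne (hne i b).symm _ _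
    simp only [Sum.elim_inl, h₁, h₂]
  · have h₁ : (fun b => Function.update v (f i) (D (v (f i))) (f b)) =
        Function.update (fun b => v (f b)) i (D (v (f i))) :=
      Function.update_comp_eq_of_injective v hf i _
    have h₂ : (fun a => Function.update v (f i) (D (v (f i))) (e a)) = fun a => v (e a) :=
      funext fun a => Function.update_of_ne (hne a i) _ _
    simp only [Sum.elim_inr, h₁, h₂]

/-- The bracket as a biadditive map. -/
def DGLA.brHom {K : Type} [Field K] (A : DGLA K) : A.carrier →+ A.carrier →+ A.carrier :=
  AddMonoidHom.mk' (fun x => AddMonoidHom.mk' (A.br x) (A.br_lin₂ x).map_add)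
    fun x y => AddMonoidHom.ext fun z => (A.br_lin₁ z).map_add x y

/-- Equivariance of the Taylor coefficients, for any tuple in `H¹` and any `g ∈ H⁰` acting
compatibly with the splitting. -/
theorem IsTransfer.br_iota {K : Type} [Field K] {A : DGLA K} {S : GradedSplitting A}
    {C : ContractionData A S} {ι bh : (p : ℕ) → (Fin p → A.carrier) → A.carrier}
    (hT : IsTransfer A S C ι bh) {g : A.carrier} (hg : g ∈ S.H 0)
    (hH : ∀ i : ℤ, ∀ x ∈ S.H i, A.br g x ∈ S.H i)
    (hK : ∀ i : ℤ, ∀ x ∈ S.Kc i, A.br g x ∈ S.Kc i) (p : ℕ) (hp : 1 ≤ p)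
    (v : Fin p → A.carrier) (hv : ∀ i, v i ∈ S.H 1) :
    A.br (ι p v) g = ∑ i : Fin p, ι p (Function.update v i (A.br (v i) g)) := by
  have hg0 := S.H_le 0 hg
  induction p using Nat.strong_induction_on with
  | _ p ih =>
    obtain _ | _ | p := p
    · omega
    · simp [hT.iota_one]
    have hw (j : Fin (p + 2)) : ∀ i, Function.update v j (A.br (v j) g) i ∈ S.H 1 := by
      intro i
      rcases eq_or_ne i j with rfl | hij
      · rw [Function.update_self, A.br_skew_of_degree_zero hg0]
        exact neg_mem (hH 1 _ (hv i))
      · rw [Function.update_of_ne hij]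
        exact hv i
    rw [Finset.sum_congr rfl fun j _ => hT.iota_rec p (fun _ => 1) _ (hw j),
      hT.iota_rec p (fun _ => 1) v hv, ← Finset.smul_sum, (A.br_lin₁ g).map_smul,
      Finset.sum_comm]
    congr 1
    have hsum {κ : Type} (s : Finset κ) (F : κ → A.carrier) :
        A.br (∑ i ∈ s, F i) g = ∑ i ∈ s, A.br (F i) g :=
      map_sum (IsLinearMap.mk' _ (A.br_lin₁ g)) F s
    rw [hsum]
    refine Finset.sum_congr rfl fun k hk => ?_
    rw [hsum, Finset.sum_comm]
    refine Finset.sum_congr rfl fun σ _ => ?_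
    rw [(A.br_lin₁ g).map_smul, ← Finset.smul_sum, ← C.h_br hg hH hK]
    congr 1
    obtain ⟨hk0, hk2⟩ := Finset.mem_Ioo.1 hk
    have hbij : Function.Bijective (Sum.elim (fun i : Fin k => σ (finIdx p (i : ℕ)))
        (fun i : Fin (p + 2 - k) => σ (finIdx p (k + (i : ℕ))))) := by
      have := σ.bijective.comp (finIdx_sum_bijective hk2)
      rwa [Sum.comp_elim] at this
    have hblocks := derivation_blocks hbij A.brHom (fun x => A.br x g)
      (A.br_br_of_degree_zero hg0) (ι k) (ι (p + 2 - k)) v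
      (ih k hk2 hk0 _ fun _ => hv _) (ih (p + 2 - k) (by omega) (by omega) _ fun _ => hv _)
    exact (congrArg C.h hblocks).trans (map_sum (IsLinearMap.mk' _ C.h_lin) _ _)

/-- **Lemma (equivariance of the Taylor coefficients).**  In the standing setup of
degree `2`: for every `p ≥ 1`, all `ξ₁, …, ξ_p ∈ H^1` and every `g ∈ H^0`,
`[ι_p(ξ₁, …, ξ_p), ι₁(g)] = Σ_{i=1}^p ι_p(ξ₁, …, {ξ_i, g}₂, …, ξ_p)`,
where `{ξ, g}₂ = π [ι₁ ξ, ι₁ g]` is the transferred binary bracket. -/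
theorem transfer_equivariance
    {K : Type} [Field K] [CharZero K]
    (A : QCyclicDGLA K 2) (S : GradedSplitting A.toDGLA)
    (h1 : ∀ i : ℤ, i < 0 → S.H i = ⊥)
    (h2 : ∀ x ∈ S.H 0, ∀ y ∈ S.H 0, A.br x y ∈ S.H 0)
    (h3H : ∀ i : ℤ, ∀ g ∈ S.H 0, ∀ x ∈ S.H i, A.br g x ∈ S.H i)
    (h3K : ∀ i : ℤ, ∀ g ∈ S.H 0, ∀ x ∈ S.Kc i, A.br g x ∈ S.Kc i)
    (hperp : ∀ i j : ℤ, ∀ x ∈ S.H i, ∀ y ∈ S.Kc j, A.form x y = 0)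
    (C : ContractionData A.toDGLA S)
    (ι bh : (p : ℕ) → (Fin p → A.carrier) → A.carrier)
    (hT : IsTransfer A.toDGLA S C ι bh) :
    ∀ (p : ℕ), 1 ≤ p → ∀ v : Fin p → A.carrier, (∀ i, v i ∈ S.H 1) →
      ∀ g ∈ S.H 0,
        A.br (ι p v) g =
          ∑ i : Fin p, ι p (Function.update v i (C.pr (A.br (v i) g))) := by
  intro p hp v hv g hg
  have hpr : ∀ i, C.pr (A.br (v i) g) = A.br (v i) g := fun i => C.pr_H 1 _ <| by
    rw [A.br_skew_of_degree_zero (S.H_le 0 hg)]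
    exact neg_mem (h3H 1 g hg _ (hv i))
  simp only [hpr]
  exact hT.br_iota hg (fun i => h3H i g hg) (fun i => h3K i g hg) p hp v hv
end

section
/- Let (L,d,[-,-],(-,-)) be a quasi-cyclic DG-Lie algebra of degree n ≤ 0 over a field K of characteristic 0 admitting a splitting L = H ⊕ d(K) ⊕ K with H^i = 0 for all i < 0 and H^0 ⊆ L^0 closed under the bracket. Then H^i(L) = 0 for all i ≠ 0, the inclusion of the Lie algebra H^0 (with zero differential) into L is a quasi-isomorphism of DG-Lie algebras, and in particular L is formal. -/
variable {K : Type} [Field K]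

namespace DGLA

variable (A : DGLA K)

/-- A homogeneous element of `range d` is `d` of a homogeneous element. -/
theorem exists_mem_grading_of_mem_coboundaries {i : ℤ} {x : A.carrier}
    (hx : x ∈ A.coboundaries i) : ∃ y ∈ A.grading (i - 1), A.d y = x := by
  classical
  let _ : DirectSum.Decomposition A.grading := A.internal.chooseDecomposition
  obtain ⟨hxi, y, rfl⟩ := hx
  have key : ∀ z : A.carrier,
      (DirectSum.decompose A.grading (A.dHom z) i : A.carrier) =
        A.dHom (DirectSum.decompose A.grading z (i - 1)) := by
    intro z
    induction z using DirectSum.Decomposition.inductionOn A.grading with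
    | zero => simp
    | @homogeneous j m =>
      have hd : A.dHom m ∈ A.grading (j + 1) := A.d_mem j m m.2
      by_cases hj : j + 1 = i
      · subst hj
        rw [DirectSum.decompose_of_mem_same A.grading hd,
          DirectSum.decompose_of_mem_same A.grading (by simp)]
      · rw [DirectSum.decompose_of_mem_ne A.grading hd hj,
          DirectSum.decompose_of_mem_ne A.grading m.2 (by omega), map_zero]
    | add a b ha hb => simp [ha, hb]
  refine ⟨DirectSum.decompose A.grading y (i - 1), SetLike.coe_mem _, ?_⟩
  have key' := key y
  rw [DirectSum.decompose_of_mem_same A.grading hxi] at key'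
  exact key'.symm

/-- A submodule of the degree `0` part that is closed under the bracket, as a DGLA concentrated
in degree `0` with zero differential. -/
def degreeZeroSubalgebra (V : Submodule K A.carrier) (hV : V ≤ A.grading 0)
    (hbr : ∀ x ∈ V, ∀ y ∈ V, A.br x y ∈ V) : DGLA K where
  carrier := V
  grading i := if i = 0 then ⊤ else ⊥
  internal := by
    rw [DirectSum.isInternal_submodule_iff_iSupIndep_and_iSup_eq_top]
    refine ⟨fun i => ?_, ?_⟩
    · by_cases hi : i = 0
      · subst hi
        refine Disjoint.mono_right (iSup₂_le fun j hj => ?_) disjoint_bot_right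
        simp [hj]
      · simp [hi]
    · exact top_unique (le_iSup_of_le 0 (by simp))
  d _ := 0
  d_lin := (0 : V →ₗ[K] V).isLinear
  d_mem _ _ _ := zero_mem _
  d_sq _ := rfl
  br x y := ⟨A.br x y, hbr x x.2 y y.2⟩
  br_lin₁ y := ⟨fun a b => Subtype.ext ((A.br_lin₁ y).map_add a b),
    fun c a => Subtype.ext ((A.br_lin₁ y).map_smul c a)⟩
  br_lin₂ x := ⟨fun a b => Subtype.ext ((A.br_lin₂ x).map_add a b),
    fun c a => Subtype.ext ((A.br_lin₂ x).map_smul c a)⟩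
  br_mem i j x hx y hy := by
    by_cases hi : i = 0
    · by_cases hj : j = 0
      · simp [hi, hj]
      · obtain rfl : y = 0 := by simpa [hj] using hy
        exact SetLike.le_def.1 bot_le ((Submodule.mem_bot K).2 (Subtype.ext (A.br_lin₂ x).map_zero))
    · obtain rfl : x = 0 := by simpa [hi] using hx
      exact SetLike.le_def.1 bot_le ((Submodule.mem_bot K).2 (Subtype.ext (A.br_lin₁ y).map_zero))
  skew i j x hx y hy := by
    apply Subtype.ext
    by_cases hi : i = 0
    · subst hi
      simpa using A.skew 0 0 x (hV x.2) y (hV y.2)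
    · obtain rfl : x = 0 := by simpa [hi] using hx
      simp [(A.br_lin₁ _).map_zero, (A.br_lin₂ _).map_zero]
  jacobi i j x hx y hy z := by
    apply Subtype.ext
    by_cases hi : i = 0
    · subst hi
      simpa using A.jacobi 0 0 x (hV x.2) y (hV y.2) z
    · obtain rfl : x = 0 := by simpa [hi] using hx
      simp [(A.br_lin₁ _).map_zero, (A.br_lin₂ _).map_zero]
  leibniz i x hx y := by
    apply Subtype.ext
    simp [(A.br_lin₁ _).map_zero, (A.br_lin₂ _).map_zero]

theorem eq_zero_of_mem_degreeZeroSubalgebra_grading {V : Submodule K A.carrier}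
    {hV : V ≤ A.grading 0} {hbr : ∀ x ∈ V, ∀ y ∈ V, A.br x y ∈ V} {i : ℤ} (hi : i ≠ 0) {x : V}
    (hx : x ∈ (A.degreeZeroSubalgebra V hV hbr).grading i) : x = 0 := by
  have h : (A.degreeZeroSubalgebra V hV hbr).grading i = ⊥ := if_neg hi
  rw [h] at hx
  exact (Submodule.mem_bot K).1 hx

/-- The inclusion of a degree `0` subalgebra consisting of cocycles. -/
def degreeZeroInclusion (V : Submodule K A.carrier) (hV : V ≤ A.grading 0)
    (hbr : ∀ x ∈ V, ∀ y ∈ V, A.br x y ∈ V) (hd : ∀ x ∈ V, A.d x = 0) :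
    DGLAHom (A.degreeZeroSubalgebra V hV hbr) A where
  toFun := V.subtype
  lin := V.subtype.isLinear
  map_grading i x hx := by
    by_cases hi : i = 0
    · subst hi
      exact hV x.2
    · obtain rfl := A.eq_zero_of_mem_degreeZeroSubalgebra_grading hi hx
      exact zero_mem _
  map_d x := (hd x.1 x.2).symm
  map_br _ _ := rfl

end DGLA

namespace GradedSplitting

variable {A : DGLA K} (S : GradedSplitting A)

theorem exists_eq_add (i : ℤ) {x : A.carrier} (hx : x ∈ A.grading i) :
    ∃ a ∈ S.H i, ∃ b ∈ S.Kc (i - 1), ∃ c ∈ S.Kc i, x = a + A.d b + c := by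
  rw [← S.decomp i] at hx
  obtain ⟨a, ha, w, hw, rfl⟩ := Submodule.mem_sup.1 hx
  obtain ⟨_, ⟨b, hb, rfl⟩, c, hc, rfl⟩ := Submodule.mem_sup.1 hw
  exact ⟨a, ha, b, hb, c, hc, (add_assoc _ _ _).symm⟩

theorem d_add_add {i : ℤ} {a b c : A.carrier} (ha : a ∈ S.H i) :
    A.d (a + A.d b + c) = A.d c := by
  rw [A.d_lin.map_add, A.d_lin.map_add, A.d_sq, S.d_H i a ha, zero_add, zero_add]

theorem exists_eq_add_of_mem_cocycles {i : ℤ} {x : A.carrier} (hx : x ∈ A.cocycles i) :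
    ∃ a ∈ S.H i, ∃ b ∈ S.Kc (i - 1), x = a + A.d b := by
  obtain ⟨a, ha, b, hb, c, hc, rfl⟩ := S.exists_eq_add i hx.1
  have h0 : A.d c = 0 := (S.d_add_add ha).symm.trans hx.2
  obtain rfl := S.d_Kc_inj i c hc h0
  exact ⟨a, ha, b, hb, add_zero _⟩

theorem d_mem_coboundaries {i : ℤ} {b : A.carrier} (hb : b ∈ S.Kc (i - 1)) :
    A.d b ∈ A.coboundaries i :=
  ⟨by simpa using A.d_mem (i - 1) b (S.Kc_le _ hb), b, rfl⟩

theorem cocycles_le_coboundaries {i : ℤ} (h : S.H i = ⊥) :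
    A.cocycles i ≤ A.coboundaries i := by
  intro x hx
  obtain ⟨a, ha, b, hb, rfl⟩ := S.exists_eq_add_of_mem_cocycles hx
  rw [h, Submodule.mem_bot] at ha
  rw [ha, zero_add]
  exact S.d_mem_coboundaries hb

theorem disjoint_H_coboundaries (i : ℤ) : Disjoint (S.H i) (A.coboundaries i) := by
  rw [Submodule.disjoint_def]
  intro x hx hxb
  obtain ⟨y, hy, rfl⟩ := A.exists_mem_grading_of_mem_coboundaries hxb
  obtain ⟨a, ha, b, hb, c, hc, rfl⟩ := S.exists_eq_add _ hy
  rw [S.d_add_add ha] at hx ⊢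
  exact Submodule.disjoint_def.1 (S.disj₁ i) _ hx
    (Submodule.mem_sup_left (Submodule.mem_map_of_mem (f := A.dHom) hc))

theorem degreeZeroInclusion_isQuasiIso
    (hbr : ∀ x ∈ S.H 0, ∀ y ∈ S.H 0, A.br x y ∈ S.H 0)
    (hacyc : ∀ i : ℤ, i ≠ 0 → A.cocycles i ≤ A.coboundaries i) :
    (A.degreeZeroInclusion (S.H 0) (S.H_le 0) hbr (S.d_H 0)).IsQuasiIso := by
  intro i
  refine ⟨fun x hx hxb => ?_, fun y hy => ?_⟩
  · suffices x = 0 by rw [this]; exact zero_mem _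
    by_cases hi : i = 0
    · subst hi
      exact Subtype.ext (Submodule.disjoint_def.1 (S.disjoint_H_coboundaries 0) _ x.2 hxb)
    · exact A.eq_zero_of_mem_degreeZeroSubalgebra_grading hi hx.1
  · by_cases hi : i = 0
    · subst hi
      obtain ⟨a, ha, b, hb, rfl⟩ := S.exists_eq_add_of_mem_cocycles hy
      refine ⟨⟨a, ha⟩, ⟨Submodule.mem_top (R := K) (M := S.H 0), rfl⟩, ?_⟩
      have : a - (a + A.d b) = -A.d b := by abel
      exact this ▸ neg_mem (S.d_mem_coboundaries hb)
    · refine ⟨0, zero_mem _, ?_⟩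
      have : (0 : A.carrier) - y = -y := zero_sub y
      exact this ▸ neg_mem (hacyc i hi hy)

end GradedSplitting

/-- By duality, if every cocycle of degree `n - i` is exact, so is every cocycle of degree `i`. -/
theorem QCyclicDGLA.cocycles_le_coboundaries {n : ℤ} (A : QCyclicDGLA K n) {i : ℤ}
    (h : A.cocycles (n - i) ≤ A.coboundaries (n - i)) :
    A.cocycles i ≤ A.coboundaries i := by
  refine fun x hx => A.nondeg i x hx fun y hy => ?_
  obtain ⟨-, z, rfl⟩ := h hy
  have hdx : A.d x = 0 := hx.2
  have hform := A.form_d i x hx.1 z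
  rw [hdx, (A.form_lin₁ z).map_zero] at hform
  exact (mul_eq_zero.1 hform.symm).resolve_left (zpow_ne_zero _ (by simp))

/-- For a quasi-cyclic DGLA of degree `n ≤ 0` with a splitting `L = H ⊕ d(K) ⊕ K`
such that `H^i = 0` for `i < 0` and `H^0` is closed under the bracket:
`H^i(L) = 0` for all `i ≠ 0`, the inclusion of the Lie algebra `H^0` (viewed as a
DGLA concentrated in degree `0` with zero differential) into `L` is a
quasi-isomorphism of DGLAs, and in particular `L` is formal. -/
theorem formality_of_quasiCyclic_nonpositive_degree
    {K : Type} [Field K] [CharZero K] {n : ℤ} (hn : n ≤ 0)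
    (A : QCyclicDGLA K n) (S : GradedSplitting A.toDGLA)
    (h1 : ∀ i : ℤ, i < 0 → S.H i = ⊥)
    (h2 : ∀ x ∈ S.H 0, ∀ y ∈ S.H 0, A.br x y ∈ S.H 0) :
    -- `H^i(L) = 0` for `i ≠ 0`
    (∀ i : ℤ, i ≠ 0 → A.toDGLA.cocycles i ≤ A.toDGLA.coboundaries i) ∧
    -- the inclusion of the Lie algebra `H^0` (zero differential, concentrated in
    -- degree `0`, with image the subspace `H^0 ⊆ L^0`) is a quasi-isomorphism
    (∃ (B : DGLA K) (f : DGLAHom B A.toDGLA),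
      (∀ x, B.d x = 0) ∧ (∀ i : ℤ, i ≠ 0 → B.grading i = ⊥) ∧
      Function.Injective f.toFun ∧
      Set.range f.toFun = (S.H 0 : Set A.carrier) ∧
      f.IsQuasiIso) ∧
    -- in particular `L` is formal
    A.toDGLA.IsFormal := by
  have hacyc : ∀ i : ℤ, i ≠ 0 → A.toDGLA.cocycles i ≤ A.toDGLA.coboundaries i := by
    intro i hi
    rcases lt_or_gt_of_ne hi with hi | hi
    · exact S.cocycles_le_coboundaries (h1 i hi)
    · exact A.cocycles_le_coboundaries (S.cocycles_le_coboundaries (h1 _ (by omega)))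
  have hq := S.degreeZeroInclusion_isQuasiIso h2 hacyc
  refine ⟨hacyc, ⟨_, _, fun _ => rfl, fun i hi => if_neg hi, Subtype.val_injective,
    Subtype.range_coe, hq⟩, ⟨_, fun _ => rfl, .symm (.of ⟨_, hq⟩)⟩⟩
end
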